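/- Let n ≥ 2 and let g = (g_{ij}) be a smooth field of symmetric invertible n×n matrices on an open set U ⊆ ℝ^n, with Christoffel symbols Γ^k_{ij} := ½ Σ_l g^{kl}(∂_i g_{lj} + ∂_j g_{li} − ∂_l g_{ij}). Let X = (X^1,…,X^n) be a smooth vector field on U which is projective, i.e., there exists a smooth map μ = (μ_1,…,μ_n) : U → ℝ^n such that for all i,j,k: X^a ∂_a Γ^i_{jk} − Γ^a_{jk} ∂_a X^i + Γ^i_{ak} ∂_j X^a + Γ^i_{ja} ∂_k X^a + ∂_j∂_k X^i = μ_j δ^i_k + μ_k δ^i_j (summation over a). Define X_i := Σ_a g_{ia} X^a, X_{i;j} := ∂_j X_i − Σ_k Γ^k_{ji} X_k, X_{(i;j)} := ½(X_{i;j} + X_{j;i}), and div X := Σ_i ∂_i X^i + Σ_{i,j} X^j Γ^i_{ij}. Then for every C² geodesic γ : I → U of Γ, the function t ↦ Σ_{i,j} (X_{(i;j)} − (2/(n+1))·(div X)·g_{ij})(γ(t))·(γ^i)′(t)(γ^j)′(t) is constant on I. -/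

import Mathlib

/-- Partial derivative `∂_i f` of a function on `ℝ^n`. -/
noncomputable def pderiv' (n : ℕ) (f : (Fin n → ℝ) → ℝ) (i : Fin n) (p : Fin n → ℝ) : ℝ :=
  fderiv ℝ f p (Pi.single i 1)

/-- The Christoffel symbols `Γ^k_{ij} = ½ Σ_l g^{kl}(∂_i g_{lj} + ∂_j g_{li} − ∂_l g_{ij})`
of a field `g` of invertible symmetric matrices. -/
noncomputable def christoffel (n : ℕ) (g : (Fin n → ℝ) → Fin n → Fin n → ℝ)
    (k i j : Fin n) (p : Fin n → ℝ) : ℝ :=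
  (1 / 2) * ∑ l, (Matrix.of (g p))⁻¹ k l *
    (pderiv' n (fun q => g q l j) i p + pderiv' n (fun q => g q l i) j p
      - pderiv' n (fun q => g q i j) l p)

/-- The lowered vector field `X_i = Σ_a g_{ia} X^a`. -/
noncomputable def lowerX (n : ℕ) (g : (Fin n → ℝ) → Fin n → Fin n → ℝ)
    (X : (Fin n → ℝ) → Fin n → ℝ) (p : Fin n → ℝ) (i : Fin n) : ℝ :=
  ∑ a, g p i a * X p a

/-- The covariant derivative `X_{i;j} = ∂_j X_i − Σ_k Γ^k_{ji} X_k`. -/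
noncomputable def covX (n : ℕ) (g : (Fin n → ℝ) → Fin n → Fin n → ℝ)
    (X : (Fin n → ℝ) → Fin n → ℝ) (p : Fin n → ℝ) (i j : Fin n) : ℝ :=
  pderiv' n (fun q => lowerX n g X q i) j p
    - ∑ k, christoffel n g k j i p * lowerX n g X p k

/-- The symmetrization `X_{(i;j)} = ½(X_{i;j} + X_{j;i})`. -/
noncomputable def symX (n : ℕ) (g : (Fin n → ℝ) → Fin n → Fin n → ℝ)
    (X : (Fin n → ℝ) → Fin n → ℝ) (p : Fin n → ℝ) (i j : Fin n) : ℝ :=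
  (1 / 2) * (covX n g X p i j + covX n g X p j i)

/-- The divergence `div X = Σ_i ∂_i X^i + Σ_{i,j} X^j Γ^i_{ij}`. -/
noncomputable def divX (n : ℕ) (g : (Fin n → ℝ) → Fin n → Fin n → ℝ)
    (X : (Fin n → ℝ) → Fin n → ℝ) (p : Fin n → ℝ) : ℝ :=
  ∑ i, pderiv' n (fun q => X q i) i p + ∑ i, ∑ j, X p j * christoffel n g i i j p

theorem pderiv'_add {n : ℕ} {f h : (Fin n → ℝ) → ℝ} {p : Fin n → ℝ}
    (hf : DifferentiableAt ℝ f p) (hh : DifferentiableAt ℝ h p) (i : Fin n) :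
    pderiv' n (fun q => f q + h q) i p = pderiv' n f i p + pderiv' n h i p := by
  simp only [pderiv']
  rw [fderiv_fun_add hf hh]
  rfl

theorem pderiv'_sub {n : ℕ} {f h : (Fin n → ℝ) → ℝ} {p : Fin n → ℝ}
    (hf : DifferentiableAt ℝ f p) (hh : DifferentiableAt ℝ h p) (i : Fin n) :
    pderiv' n (fun q => f q - h q) i p = pderiv' n f i p - pderiv' n h i p := by
  simp only [pderiv']
  rw [fderiv_fun_sub hf hh]
  rfl

theorem pderiv'_mul {n : ℕ} {f h : (Fin n → ℝ) → ℝ} {p : Fin n → ℝ}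
    (hf : DifferentiableAt ℝ f p) (hh : DifferentiableAt ℝ h p) (i : Fin n) :
    pderiv' n (fun q => f q * h q) i p = pderiv' n f i p * h p + f p * pderiv' n h i p := by
  simp only [pderiv']
  rw [fderiv_fun_mul hf hh]
  simp
  ring

theorem pderiv'_const_mul {n : ℕ} (c : ℝ) {f : (Fin n → ℝ) → ℝ} {p : Fin n → ℝ}
    (hf : DifferentiableAt ℝ f p) (i : Fin n) :
    pderiv' n (fun q => c * f q) i p = c * pderiv' n f i p := by
  rw [pderiv'_mul (differentiableAt_const c) hf]
  simp [pderiv']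

theorem pderiv'_sum {n : ℕ} {ι : Type*} {s : Finset ι} {f : ι → (Fin n → ℝ) → ℝ}
    {p : Fin n → ℝ} (hf : ∀ a ∈ s, DifferentiableAt ℝ (f a) p) (i : Fin n) :
    pderiv' n (fun q => ∑ a ∈ s, f a q) i p = ∑ a ∈ s, pderiv' n (f a) i p := by
  simp only [pderiv']
  rw [fderiv_fun_sum hf]
  simp

theorem pderiv'_congr {n : ℕ} {f h : (Fin n → ℝ) → ℝ} {U : Set (Fin n → ℝ)} (hU : IsOpen U)
    (heq : ∀ q ∈ U, f q = h q) {p : Fin n → ℝ} (hp : p ∈ U) (i : Fin n) :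
    pderiv' n f i p = pderiv' n h i p := by
  simp only [pderiv']
  rw [Filter.EventuallyEq.fderiv_eq (Filter.eventually_of_mem (hU.mem_nhds hp) heq)]

theorem contDiffOn_pderiv' {n : ℕ} {f : (Fin n → ℝ) → ℝ} {U : Set (Fin n → ℝ)} (hU : IsOpen U)
    (hf : ContDiffOn ℝ (⊤ : ℕ∞) f U) (i : Fin n) :
    ContDiffOn ℝ (⊤ : ℕ∞) (pderiv' n f i) U :=
  (hf.fderiv_of_isOpen hU (m := (⊤ : ℕ∞)) (by simp)).clm_apply contDiffOn_const

theorem ContDiffOn.differentiableAt_of_mem_isOpen {n : ℕ} {f : (Fin n → ℝ) → ℝ}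
    {U : Set (Fin n → ℝ)} (hf : ContDiffOn ℝ (⊤ : ℕ∞) f U) (hU : IsOpen U)
    {p : Fin n → ℝ} (hp : p ∈ U) : DifferentiableAt ℝ f p :=
  (hf.contDiffAt (hU.mem_nhds hp)).differentiableAt (by simp)

theorem pderiv'_comm {n : ℕ} {f : (Fin n → ℝ) → ℝ} {U : Set (Fin n → ℝ)} (hU : IsOpen U)
    (hf : ContDiffOn ℝ (⊤ : ℕ∞) f U) {p : Fin n → ℝ} (hp : p ∈ U) (i j : Fin n) :
    pderiv' n (pderiv' n f i) j p = pderiv' n (pderiv' n f j) i p := by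
  have hc := hf.contDiffAt (hU.mem_nhds hp)
  have hd : DifferentiableAt ℝ (fderiv ℝ f) p :=
    ((hf.fderiv_of_isOpen hU (m := (⊤ : ℕ∞)) (by simp)).contDiffAt
      (hU.mem_nhds hp)).differentiableAt (by simp)
  have hsymm : IsSymmSndFDerivAt ℝ f p := hc.isSymmSndFDerivAt (by
    rw [minSmoothness_of_isRCLikeNormedField]
    exact WithTop.coe_le_coe.2 le_top)
  have key (v w : Fin n → ℝ) :
      fderiv ℝ (fun q => fderiv ℝ f q v) p w = fderiv ℝ (fderiv ℝ f) p w v := by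
    rw [fderiv_clm_apply hd (differentiableAt_const v)]
    simp
  change fderiv ℝ (fun q => fderiv ℝ f q _) p _ = fderiv ℝ (fun q => fderiv ℝ f q _) p _
  rw [key, key]
  exact hsymm.eq _ _

theorem hasDerivAt_comp_curve {n : ℕ} {f : (Fin n → ℝ) → ℝ} {γ : ℝ → Fin n → ℝ}
    {v : Fin n → ℝ} {t : ℝ} (hf : DifferentiableAt ℝ f (γ t))
    (hγ : ∀ k, HasDerivAt (fun τ => γ τ k) (v k) t) :
    HasDerivAt (fun τ => f (γ τ)) (∑ k, pderiv' n f k (γ t) * v k) t := by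
  have h := hf.hasFDerivAt.comp_hasDerivAt t (hasDerivAt_pi.2 hγ)
  refine h.congr_deriv ?_
  rw [congrArg (fderiv ℝ f (γ t)) (pi_eq_sum_univ' v), map_sum]
  refine Finset.sum_congr rfl fun k _ => ?_
  rw [map_smul, smul_eq_mul, mul_comm, pderiv']

theorem contDiffOn_matrix_det {n : ℕ} {M : (Fin n → ℝ) → Matrix (Fin n) (Fin n) ℝ}
    {U : Set (Fin n → ℝ)} (hM : ∀ i j, ContDiffOn ℝ (⊤ : ℕ∞) (fun p => M p i j) U) :
    ContDiffOn ℝ (⊤ : ℕ∞) (fun p => (M p).det) U := by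
  simp only [Matrix.det_apply']
  exact ContDiffOn.sum fun σ _ => contDiffOn_const.mul (contDiffOn_prod fun i _ => hM _ _)

theorem contDiffOn_matrix_inv {n : ℕ} {M : (Fin n → ℝ) → Matrix (Fin n) (Fin n) ℝ}
    {U : Set (Fin n → ℝ)} (hM : ∀ i j, ContDiffOn ℝ (⊤ : ℕ∞) (fun p => M p i j) U)
    (hdet : ∀ p ∈ U, IsUnit (M p).det) (i j : Fin n) :
    ContDiffOn ℝ (⊤ : ℕ∞) (fun p => (M p)⁻¹ i j) U := by
  simp only [Matrix.inv_def, Ring.inverse_eq_inv', Matrix.smul_apply, smul_eq_mul,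
    Matrix.adjugate_apply]
  refine ((contDiffOn_matrix_det hM).inv fun p hp => (hdet p hp).ne_zero).mul
    (contDiffOn_matrix_det fun k l => ?_)
  by_cases hk : k = j
  · subst hk
    simpa using contDiffOn_const
  · simpa [Matrix.updateRow_ne hk] using hM k l

/-- The Lie derivative along `X` of the compatibility `∂_k g_{ij} = g_{mj} Γ^m_{ki} + g_{im} Γ^m_{kj}`
of a connection with a metric, at a single point. Here `gd i j k` stands for `∂_k g_{ij}`,
`gdd i j k a` for `∂_a ∂_k g_{ij}`, `Gd m k i a` for `∂_a Γ^m_{ki}`, `Xd a i` for `∂_i X^a`,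
`Xdd a i k` for `∂_k ∂_i X^a` and `P` for the Lie derivative of the connection. -/
theorem lie_derivative_metric_compatibility {ι : Type*} [Fintype ι]
    {g : ι → ι → ℝ} {gd : ι → ι → ι → ℝ} {gdd : ι → ι → ι → ι → ℝ} {G : ι → ι → ι → ℝ}
    {Gd : ι → ι → ι → ι → ℝ} {X : ι → ℝ} {Xd : ι → ι → ℝ} {Xdd P : ι → ι → ι → ℝ}
    (hgd : ∀ i j k, gd i j k = ∑ m, (g m j * G m k i + g i m * G m k j))
    (hgdd : ∀ i j k a, gdd i j k a =
      ∑ m, (gd m j a * G m k i + g m j * Gd m k i a + (gd i m a * G m k j + g i m * Gd m k j a)))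
    (hP : ∀ m k i, ∑ a, X a * Gd m k i a - ∑ a, G a k i * Xd m a + ∑ a, G m a i * Xd a k
      + ∑ a, G m k a * Xd a i + Xdd m i k = P m k i) (i j k : ι) :
    ∑ a, (Xd a k * gd i j a + X a * gdd i j k a + (gd a j k * Xd a i + g a j * Xdd a i k)
        + (gd i a k * Xd a j + g i a * Xdd a j k)) =
      ∑ m, (G m k i * ∑ a, (X a * gd m j a + g a j * Xd a m + g m a * Xd a j)
        + G m k j * ∑ a, (X a * gd i m a + g a m * Xd a i + g i a * Xd a m))
      + ∑ m, (g m j * P m k i + g i m * P m k j) := by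
  have hL : ∑ a, (Xd a k * gd i j a + X a * gdd i j k a + (gd a j k * Xd a i + g a j * Xdd a i k)
        + (gd i a k * Xd a j + g i a * Xdd a j k)) =
      ∑ m, ∑ a, (Xd a k * (g m j * G m a i + g i m * G m a j)
        + X a * (gd m j a * G m k i + g m j * Gd m k i a
          + (gd i m a * G m k j + g i m * Gd m k j a))
        + (g m j * G m k a + g a m * G m k j) * Xd a i
        + (g m a * G m k i + g i m * G m k a) * Xd a j)
      + ∑ a, (g a j * Xdd a i k + g i a * Xdd a j k) := by
    rw [Finset.sum_comm, ← Finset.sum_add_distrib]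
    refine Finset.sum_congr rfl fun a _ => ?_
    rw [hgdd, hgd i j a, hgd a j k, hgd i a k]
    simp only [Finset.sum_add_distrib, ← Finset.mul_sum, ← Finset.sum_mul]
    ring
  have hR : ∑ m, (g m j * P m k i + g i m * P m k j) =
      ∑ m, ∑ a, (g m j * (X a * Gd m k i a - G a k i * Xd m a + G m a i * Xd a k
          + G m k a * Xd a i)
        + g i m * (X a * Gd m k j a - G a k j * Xd m a + G m a j * Xd a k + G m k a * Xd a j))
      + ∑ a, (g a j * Xdd a i k + g i a * Xdd a j k) := by
    rw [← Finset.sum_add_distrib]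
    refine Finset.sum_congr rfl fun m _ => ?_
    rw [← hP m k i, ← hP m k j]
    simp only [Finset.sum_add_distrib, Finset.sum_sub_distrib, ← Finset.mul_sum]
    ring
  have hswap : ∑ m, ∑ a, (G m k i * (g a j * Xd a m) + G m k j * (g i a * Xd a m)) =
      ∑ m, ∑ a, (G a k i * (g m j * Xd m a) + G a k j * (g i m * Xd m a)) := Finset.sum_comm
  rw [hL, hR, ← add_assoc]
  congr 1
  refine Eq.symm (eq_of_sub_eq_zero ?_)
  rw [← sub_eq_zero.2 hswap]
  simp only [Finset.mul_sum, ← Finset.sum_add_distrib, ← Finset.sum_sub_distrib]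
  refine Finset.sum_congr rfl fun m _ => Finset.sum_congr rfl fun a _ => ?_
  ring

theorem sum_swap_first_third {ι M : Type*} [Fintype ι] [AddCommMonoid M] (F : ι → ι → ι → M) :
    ∑ i, ∑ j, ∑ k, F i j k = ∑ k, ∑ j, ∑ i, F i j k := by
  rw [Finset.sum_comm]
  simp_rw [Finset.sum_comm (f := fun i k => F i _ k)]
  rw [Finset.sum_comm]

/-- Derivative of a quadratic form along a geodesic, expressed through the covariant derivative `T`
of its coefficients `S`. -/
theorem quadratic_form_derivative_geodesic {ι : Type*} [Fintype ι] {S : ι → ι → ℝ}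
    {Sd T G : ι → ι → ι → ℝ} {v w : ι → ℝ}
    (hSd : ∀ i j k, Sd i j k = ∑ m, (G m k i * S m j + G m k j * S i m) + T i j k)
    (hw : ∀ k, w k + ∑ i, ∑ j, G k i j * v i * v j = 0) :
    ∑ i, ∑ j, (((∑ k, Sd i j k * v k) * v i + S i j * w i) * v j + S i j * v i * w j) =
      ∑ i, ∑ j, ∑ k, T i j k * v i * v j * v k := by
  have hw' (k : ι) : w k = -∑ i, ∑ j, G k i j * v i * v j := eq_neg_of_add_eq_zero_left (hw k)
  have h1 : ∑ i, ∑ j, ∑ k, ∑ m, G m k i * S m j * v i * v j * v k =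
      ∑ i, ∑ j, S i j * v j * ∑ k, ∑ l, G i k l * v k * v l := by
    rw [Finset.sum_comm]
    simp_rw [sum_swap_first_third (fun i k m => G m k i * S m _ * v i * v _ * v k)]
    rw [Finset.sum_comm]
    simp only [Finset.mul_sum]
    refine Finset.sum_congr rfl fun i _ => Finset.sum_congr rfl fun j _ =>
      Finset.sum_congr rfl fun k _ => Finset.sum_congr rfl fun l _ => ?_
    ring
  have h2 : ∑ i, ∑ j, ∑ k, ∑ m, G m k j * S i m * v i * v j * v k =
      ∑ i, ∑ j, S i j * v i * ∑ k, ∑ l, G j k l * v k * v l := by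
    simp_rw [sum_swap_first_third (fun j k m => G m k j * S _ m * v _ * v j * v k)]
    simp only [Finset.mul_sum]
    refine Finset.sum_congr rfl fun i _ => Finset.sum_congr rfl fun j _ =>
      Finset.sum_congr rfl fun k _ => Finset.sum_congr rfl fun l _ => ?_
    ring
  have h3 : ∑ i, ∑ j, (((∑ k, Sd i j k * v k) * v i + S i j * w i) * v j + S i j * v i * w j) =
      (∑ i, ∑ j, ∑ k, ∑ m, G m k i * S m j * v i * v j * v k
        + ∑ i, ∑ j, ∑ k, ∑ m, G m k j * S i m * v i * v j * v k
        + ∑ i, ∑ j, ∑ k, T i j k * v i * v j * v k)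
      - ∑ i, ∑ j, S i j * v j * ∑ k, ∑ l, G i k l * v k * v l
      - ∑ i, ∑ j, S i j * v i * ∑ k, ∑ l, G j k l * v k * v l := by
    simp only [← Finset.sum_add_distrib, ← Finset.sum_sub_distrib]
    refine Finset.sum_congr rfl fun i _ => Finset.sum_congr rfl fun j _ => ?_
    have h4 : (∑ k, Sd i j k * v k) * v i * v j =
        ∑ k, (∑ m, (G m k i * S m j * v i * v j * v k + G m k j * S i m * v i * v j * v k)
          + T i j k * v i * v j * v k) := by
      simp only [Finset.sum_mul]
      refine Finset.sum_congr rfl fun k _ => ?_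
      rw [hSd]
      simp only [add_mul, Finset.sum_mul]
      congr 1
      · exact Finset.sum_congr rfl fun m _ => by ring
      · ring
    rw [← h4, hw' i, hw' j]
    ring
  rw [h3, h1, h2]
  ring

section Metric

variable {n : ℕ} {U : Set (Fin n → ℝ)} {g : (Fin n → ℝ) → Fin n → Fin n → ℝ}
  {X : (Fin n → ℝ) → Fin n → ℝ}

theorem contDiffOn_christoffel (hU : IsOpen U)
    (hg : ∀ i j, ContDiffOn ℝ (⊤ : ℕ∞) (fun p => g p i j) U)
    (hinv : ∀ p ∈ U, IsUnit (Matrix.of (g p)).det) (k i j : Fin n) :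
    ContDiffOn ℝ (⊤ : ℕ∞) (christoffel n g k i j) U :=
  contDiffOn_const.mul <| ContDiffOn.sum fun l _ =>
    (contDiffOn_matrix_inv (M := fun p => Matrix.of (g p)) hg hinv k l).mul
      (((contDiffOn_pderiv' hU (hg l j) i).add (contDiffOn_pderiv' hU (hg l i) j)).sub
        (contDiffOn_pderiv' hU (hg i j) l))

theorem sum_metric_mul_christoffel {p : Fin n → ℝ} (hinv : IsUnit (Matrix.of (g p)).det)
    (a i j : Fin n) :
    ∑ m, g p a m * christoffel n g m i j p =
      (1 / 2) * (pderiv' n (fun q => g q a j) i p + pderiv' n (fun q => g q a i) j p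
        - pderiv' n (fun q => g q i j) a p) := by
  set c : Fin n → ℝ := fun l => pderiv' n (fun q => g q l j) i p
    + pderiv' n (fun q => g q l i) j p - pderiv' n (fun q => g q i j) l p with hc
  have h : (Matrix.of (g p)).mulVec ((Matrix.of (g p))⁻¹.mulVec c) = c := by
    rw [Matrix.mulVec_mulVec, Matrix.mul_nonsing_inv _ hinv, Matrix.one_mulVec]
  have ha := congrFun h a
  simp only [Matrix.mulVec, dotProduct, Matrix.of_apply] at ha
  rw [show (1 / 2 : ℝ) * (pderiv' n (fun q => g q a j) i p + pderiv' n (fun q => g q a i) j p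
        - pderiv' n (fun q => g q i j) a p) = 1 / 2 * c a from rfl, ← ha, Finset.mul_sum]
  refine Finset.sum_congr rfl fun m _ => ?_
  rw [christoffel]
  ring

theorem pderiv'_metric (hU : IsOpen U) (hsymm : ∀ p ∈ U, ∀ i j, g p i j = g p j i)
    (hinv : ∀ p ∈ U, IsUnit (Matrix.of (g p)).det) {p : Fin n → ℝ} (hp : p ∈ U)
    (i j k : Fin n) :
    pderiv' n (fun q => g q i j) k p =
      ∑ m, (g p m j * christoffel n g m k i p + g p i m * christoffel n g m k j p) := by
  have hs (a b c : Fin n) :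
      pderiv' n (fun q => g q a b) c p = pderiv' n (fun q => g q b a) c p :=
    pderiv'_congr hU (fun q hq => hsymm q hq a b) hp c
  simp only [hsymm p hp _ j, Finset.sum_add_distrib]
  rw [sum_metric_mul_christoffel (hinv p hp), sum_metric_mul_christoffel (hinv p hp),
    hs j i, hs k i, hs k j]
  ring

theorem inv_metric_symm (hsymm : ∀ p ∈ U, ∀ i j, g p i j = g p j i) {p : Fin n → ℝ}
    (hp : p ∈ U) (i j : Fin n) :
    (Matrix.of (g p))⁻¹ i j = (Matrix.of (g p))⁻¹ j i := by
  have h : (Matrix.of (g p)).transpose = Matrix.of (g p) := by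
    ext a b
    exact hsymm p hp b a
  conv_lhs => rw [← h, ← Matrix.transpose_nonsing_inv]
  rfl

/-- The contraction of the Christoffel symbols is the logarithmic derivative of the volume. -/
theorem sum_christoffel_self (hU : IsOpen U) (hsymm : ∀ p ∈ U, ∀ i j, g p i j = g p j i)
    {p : Fin n → ℝ} (hp : p ∈ U) (j : Fin n) :
    ∑ i, christoffel n g i i j p =
      (1 / 2) * ∑ i, ∑ l, (Matrix.of (g p))⁻¹ i l * pderiv' n (fun q => g q l i) j p := by
  have hs (a b c : Fin n) :
      pderiv' n (fun q => g q a b) c p = pderiv' n (fun q => g q b a) c p :=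
    pderiv'_congr hU (fun q hq => hsymm q hq a b) hp c
  have hcancel : ∑ i, ∑ l, (Matrix.of (g p))⁻¹ i l * pderiv' n (fun q => g q l j) i p =
      ∑ i, ∑ l, (Matrix.of (g p))⁻¹ i l * pderiv' n (fun q => g q i j) l p := by
    rw [Finset.sum_comm]
    refine Finset.sum_congr rfl fun i _ => Finset.sum_congr rfl fun l _ => ?_
    rw [inv_metric_symm hsymm hp]
  simp only [christoffel, ← Finset.mul_sum, mul_add, mul_sub, Finset.sum_add_distrib,
    Finset.sum_sub_distrib]
  rw [hcancel]
  ring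

theorem pderiv'_inv_metric (hU : IsOpen U)
    (hg : ∀ i j, ContDiffOn ℝ (⊤ : ℕ∞) (fun p => g p i j) U)
    (hinv : ∀ p ∈ U, IsUnit (Matrix.of (g p)).det) {p : Fin n → ℝ} (hp : p ∈ U) (k : Fin n) :
    Matrix.of (fun i j => pderiv' n (fun q => (Matrix.of (g q))⁻¹ i j) k p) =
      -((Matrix.of (g p))⁻¹ * Matrix.of (fun i j => pderiv' n (fun q => g q i j) k p)
        * (Matrix.of (g p))⁻¹) := by
  have hB (i j : Fin n) : DifferentiableAt ℝ (fun q => (Matrix.of (g q))⁻¹ i j) p :=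
    (contDiffOn_matrix_inv (M := fun p => Matrix.of (g p)) hg hinv i
      j).differentiableAt_of_mem_isOpen hU hp
  have hgd (i j : Fin n) : DifferentiableAt ℝ (fun q => g q i j) p :=
    (hg i j).differentiableAt_of_mem_isOpen hU hp
  have hmul : Matrix.of (fun i j => pderiv' n (fun q => (Matrix.of (g q))⁻¹ i j) k p)
      * Matrix.of (g p)
      + (Matrix.of (g p))⁻¹ * Matrix.of (fun i j => pderiv' n (fun q => g q i j) k p) = 0 := by
    ext i j
    have h1 : pderiv' n (fun q => ∑ m, (Matrix.of (g q))⁻¹ i m * g q m j) k p = 0 := by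
      rw [pderiv'_congr (h := fun _ => (1 : Matrix (Fin n) (Fin n) ℝ) i j) hU
        (fun q hq => by rw [← Matrix.nonsing_inv_mul _ (hinv q hq)]; rfl) hp]
      simp [pderiv']
    rw [pderiv'_sum fun m _ => (hB i m).fun_mul (hgd m j)] at h1
    simp only [pderiv'_mul (hB i _) (hgd _ j), Finset.sum_add_distrib] at h1
    simpa [Matrix.mul_apply] using h1
  have h2 := congrArg (· * (Matrix.of (g p))⁻¹) hmul
  simp only [add_mul, zero_mul, Matrix.mul_assoc _ (Matrix.of (g p)),
    Matrix.mul_nonsing_inv _ (hinv p hp), Matrix.mul_one] at h2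
  exact eq_neg_of_add_eq_zero_left h2

theorem sum_pderiv'_christoffel_comm (hU : IsOpen U)
    (hg : ∀ i j, ContDiffOn ℝ (⊤ : ℕ∞) (fun p => g p i j) U)
    (hsymm : ∀ p ∈ U, ∀ i j, g p i j = g p j i)
    (hinv : ∀ p ∈ U, IsUnit (Matrix.of (g p)).det) {p : Fin n → ℝ} (hp : p ∈ U)
    (j k : Fin n) :
    ∑ i, pderiv' n (christoffel n g i i j) k p = ∑ i, pderiv' n (christoffel n g i i k) j p := by
  have hB (i j : Fin n) : DifferentiableAt ℝ (fun q => (Matrix.of (g q))⁻¹ i j) p :=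
    (contDiffOn_matrix_inv (M := fun p => Matrix.of (g p)) hg hinv i
      j).differentiableAt_of_mem_isOpen hU hp
  have hgd (i j a : Fin n) : DifferentiableAt ℝ (pderiv' n (fun q => g q i j) a) p :=
    (contDiffOn_pderiv' hU (hg i j) a).differentiableAt_of_mem_isOpen hU hp
  have expand (j k : Fin n) : ∑ i, pderiv' n (christoffel n g i i j) k p =
      (1 / 2) * (-Matrix.trace ((Matrix.of (g p))⁻¹
          * Matrix.of (fun i j => pderiv' n (fun q => g q i j) k p)
          * (Matrix.of (g p))⁻¹ * Matrix.of (fun a b => pderiv' n (fun q => g q a b) j p))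
        + ∑ i, ∑ l, (Matrix.of (g p))⁻¹ i l
          * pderiv' n (pderiv' n (fun q => g q l i) j) k p) := by
    rw [← Matrix.trace_neg, ← neg_mul, ← pderiv'_inv_metric hU hg hinv hp k,
      ← pderiv'_sum fun i _ =>
        (contDiffOn_christoffel hU hg hinv i i j).differentiableAt_of_mem_isOpen hU hp,
      pderiv'_congr hU (fun q hq => sum_christoffel_self hU hsymm hq j) hp,
      pderiv'_const_mul _ (DifferentiableAt.fun_sum fun i _ => DifferentiableAt.fun_sum fun l _ =>
        (hB i l).fun_mul (hgd l i j)),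
      pderiv'_sum fun i _ => DifferentiableAt.fun_sum fun l _ => (hB i l).fun_mul (hgd l i j)]
    simp only [Matrix.trace, Matrix.diag, Matrix.mul_apply, Matrix.of_apply,
      ← Finset.sum_add_distrib]
    congr 1
    refine Finset.sum_congr rfl fun i _ => ?_
    rw [pderiv'_sum fun l _ => (hB i l).fun_mul (hgd l i j)]
    exact Finset.sum_congr rfl fun l _ => pderiv'_mul (hB i l) (hgd l i j) k
  rw [expand, expand, Matrix.mul_assoc (_ * _), Matrix.trace_mul_comm, ← Matrix.mul_assoc]
  simp only [fun l i => pderiv'_comm hU (hg l i) hp j k]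

/-- `X_{(i;j)}` is half the Lie derivative of the metric along `X`. -/
theorem symX_eq_lie_derivative (hU : IsOpen U)
    (hg : ∀ i j, ContDiffOn ℝ (⊤ : ℕ∞) (fun p => g p i j) U)
    (hsymm : ∀ p ∈ U, ∀ i j, g p i j = g p j i)
    (hinv : ∀ p ∈ U, IsUnit (Matrix.of (g p)).det)
    (hX : ∀ i, ContDiffOn ℝ (⊤ : ℕ∞) (fun p => X p i) U) {p : Fin n → ℝ} (hp : p ∈ U)
    (i j : Fin n) :
    symX n g X p i j = (1 / 2) * ∑ a, (X p a * pderiv' n (fun q => g q i j) a p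
      + g p a j * pderiv' n (fun q => X q a) i p
      + g p i a * pderiv' n (fun q => X q a) j p) := by
  have hs (a b c : Fin n) :
      pderiv' n (fun q => g q a b) c p = pderiv' n (fun q => g q b a) c p :=
    pderiv'_congr hU (fun q hq => hsymm q hq a b) hp c
  have hgd (i j : Fin n) : DifferentiableAt ℝ (fun q => g q i j) p :=
    (hg i j).differentiableAt_of_mem_isOpen hU hp
  have hXd (i : Fin n) : DifferentiableAt ℝ (fun q => X q i) p :=
    (hX i).differentiableAt_of_mem_isOpen hU hp
  have hcov (i j : Fin n) : covX n g X p i j =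
      ∑ a, (pderiv' n (fun q => g q i a) j p * X p a + g p i a * pderiv' n (fun q => X q a) j p
        - (1 / 2) * (pderiv' n (fun q => g q a i) j p + pderiv' n (fun q => g q a j) i p
          - pderiv' n (fun q => g q j i) a p) * X p a) := by
    have h1 : ∑ k, christoffel n g k j i p * lowerX n g X p k =
        ∑ a, (∑ k, g p a k * christoffel n g k j i p) * X p a := by
      simp only [lowerX, Finset.mul_sum, Finset.sum_mul]
      rw [Finset.sum_comm]
      refine Finset.sum_congr rfl fun a _ => Finset.sum_congr rfl fun k _ => ?_
      rw [hsymm p hp a k]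
      ring
    rw [covX, h1, Finset.sum_sub_distrib]
    simp only [sum_metric_mul_christoffel (hinv p hp)]
    congr 1
    simp only [lowerX]
    rw [pderiv'_sum fun a _ => (hgd i a).fun_mul (hXd a)]
    exact Finset.sum_congr rfl fun a _ => pderiv'_mul (hgd i a) (hXd a) j
  rw [symX, hcov, hcov, ← Finset.sum_add_distrib]
  congr 1
  refine Finset.sum_congr rfl fun a _ => ?_
  rw [hs a i, hs a j, hs j i, hsymm p hp a j]
  ring

theorem contDiffOn_symX (hU : IsOpen U)
    (hg : ∀ i j, ContDiffOn ℝ (⊤ : ℕ∞) (fun p => g p i j) U)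
    (hsymm : ∀ p ∈ U, ∀ i j, g p i j = g p j i)
    (hinv : ∀ p ∈ U, IsUnit (Matrix.of (g p)).det)
    (hX : ∀ i, ContDiffOn ℝ (⊤ : ℕ∞) (fun p => X p i) U) (i j : Fin n) :
    ContDiffOn ℝ (⊤ : ℕ∞) (fun p => symX n g X p i j) U :=
  (contDiffOn_const.mul <| ContDiffOn.sum fun a _ =>
    (((hX a).mul (contDiffOn_pderiv' hU (hg i j) a)).add
      ((hg a j).mul (contDiffOn_pderiv' hU (hX a) i))).add
      ((hg i a).mul (contDiffOn_pderiv' hU (hX a) j))).congr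
    fun _ hp => symX_eq_lie_derivative hU hg hsymm hinv hX hp i j

theorem contDiffOn_divX (hU : IsOpen U)
    (hg : ∀ i j, ContDiffOn ℝ (⊤ : ℕ∞) (fun p => g p i j) U)
    (hinv : ∀ p ∈ U, IsUnit (Matrix.of (g p)).det)
    (hX : ∀ i, ContDiffOn ℝ (⊤ : ℕ∞) (fun p => X p i) U) :
    ContDiffOn ℝ (⊤ : ℕ∞) (divX n g X) U :=
  (ContDiffOn.sum fun i _ => contDiffOn_pderiv' hU (hX i) i).add <|
    ContDiffOn.sum fun i _ => ContDiffOn.sum fun j _ =>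
      (hX j).mul (contDiffOn_christoffel hU hg hinv i i j)

variable {μ : (Fin n → ℝ) → Fin n → ℝ}

theorem pderiv'_symX_of_projective (hU : IsOpen U)
    (hg : ∀ i j, ContDiffOn ℝ (⊤ : ℕ∞) (fun p => g p i j) U)
    (hsymm : ∀ p ∈ U, ∀ i j, g p i j = g p j i)
    (hinv : ∀ p ∈ U, IsUnit (Matrix.of (g p)).det)
    (hX : ∀ i, ContDiffOn ℝ (⊤ : ℕ∞) (fun p => X p i) U) {p : Fin n → ℝ} (hp : p ∈ U)
    (hproj : ∀ i j k : Fin n,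
      ∑ a, X p a * pderiv' n (christoffel n g i j k) a p
        - ∑ a, christoffel n g a j k p * pderiv' n (fun q => X q i) a p
        + ∑ a, christoffel n g i a k p * pderiv' n (fun q => X q a) j p
        + ∑ a, christoffel n g i j a p * pderiv' n (fun q => X q a) k p
        + pderiv' n (fun q => pderiv' n (fun r => X r i) k q) j p
      = μ p j * (if i = k then 1 else 0) + μ p k * (if i = j then 1 else 0))
    (i j k : Fin n) :
    pderiv' n (fun q => symX n g X q i j) k p =
      ∑ m, (christoffel n g m k i p * symX n g X p m j
        + christoffel n g m k j p * symX n g X p i m)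
      + (μ p k * g p i j + (1 / 2) * (μ p i * g p k j + μ p j * g p i k)) := by
  have hg0 (i j : Fin n) : DifferentiableAt ℝ (fun q => g q i j) p :=
    (hg i j).differentiableAt_of_mem_isOpen hU hp
  have hX0 (i : Fin n) : DifferentiableAt ℝ (fun q => X q i) p :=
    (hX i).differentiableAt_of_mem_isOpen hU hp
  have hg1 (i j a : Fin n) : DifferentiableAt ℝ (pderiv' n (fun q => g q i j) a) p :=
    (contDiffOn_pderiv' hU (hg i j) a).differentiableAt_of_mem_isOpen hU hp
  have hX1 (i a : Fin n) : DifferentiableAt ℝ (pderiv' n (fun q => X q i) a) p :=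
    (contDiffOn_pderiv' hU (hX i) a).differentiableAt_of_mem_isOpen hU hp
  have hG0 (i j k : Fin n) : DifferentiableAt ℝ (christoffel n g i j k) p :=
    (contDiffOn_christoffel hU hg hinv i j k).differentiableAt_of_mem_isOpen hU hp
  have hgdd (i j k a : Fin n) : pderiv' n (pderiv' n (fun q => g q i j) k) a p =
      ∑ m, (pderiv' n (fun q => g q m j) a p * christoffel n g m k i p
          + g p m j * pderiv' n (christoffel n g m k i) a p
        + (pderiv' n (fun q => g q i m) a p * christoffel n g m k j p
          + g p i m * pderiv' n (christoffel n g m k j) a p)) := by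
    rw [pderiv'_congr hU (fun q hq => pderiv'_metric hU hsymm hinv hq i j k) hp,
      pderiv'_sum fun m _ => ((hg0 m j).fun_mul (hG0 m k i)).fun_add ((hg0 i m).fun_mul (hG0 m k j))]
    refine Finset.sum_congr rfl fun m _ => ?_
    rw [pderiv'_add ((hg0 m j).fun_mul (hG0 m k i)) ((hg0 i m).fun_mul (hG0 m k j)),
      pderiv'_mul (hg0 m j) (hG0 m k i), pderiv'_mul (hg0 i m) (hG0 m k j)]
  have key := lie_derivative_metric_compatibility (g := g p)
    (gd := fun i j k => pderiv' n (fun q => g q i j) k p)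
    (gdd := fun i j k a => pderiv' n (pderiv' n (fun q => g q i j) k) a p)
    (G := fun m k i => christoffel n g m k i p)
    (Gd := fun m k i a => pderiv' n (christoffel n g m k i) a p)
    (X := X p) (Xd := fun a i => pderiv' n (fun q => X q a) i p)
    (Xdd := fun a i k => pderiv' n (pderiv' n (fun q => X q a) i) k p)
    (fun i j k => pderiv'_metric hU hsymm hinv hp i j k) hgdd (fun m k i => hproj m k i) i j k
  have hleft : pderiv' n (fun q => symX n g X q i j) k p = (1 / 2) *
      ∑ a, (pderiv' n (fun q => X q a) k p * pderiv' n (fun q => g q i j) a p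
        + X p a * pderiv' n (pderiv' n (fun q => g q i j) k) a p
        + (pderiv' n (fun q => g q a j) k p * pderiv' n (fun q => X q a) i p
          + g p a j * pderiv' n (pderiv' n (fun q => X q a) i) k p)
        + (pderiv' n (fun q => g q i a) k p * pderiv' n (fun q => X q a) j p
          + g p i a * pderiv' n (pderiv' n (fun q => X q a) j) k p)) := by
    have hd1 (a : Fin n) := (hX0 a).fun_mul (hg1 i j a)
    have hd2 (a : Fin n) := (hg0 a j).fun_mul (hX1 a i)
    have hd3 (a : Fin n) := (hg0 i a).fun_mul (hX1 a j)
    rw [pderiv'_congr hU (fun q hq => symX_eq_lie_derivative hU hg hsymm hinv hX hq i j) hp,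
      pderiv'_const_mul _ (DifferentiableAt.fun_sum fun a _ => ((hd1 a).fun_add (hd2 a)).fun_add (hd3 a)),
      pderiv'_sum fun a _ => ((hd1 a).fun_add (hd2 a)).fun_add (hd3 a)]
    congr 1
    refine Finset.sum_congr rfl fun a _ => ?_
    rw [pderiv'_add ((hd1 a).fun_add (hd2 a)) (hd3 a), pderiv'_add (hd1 a) (hd2 a),
      pderiv'_mul (hX0 a) (hg1 i j a), pderiv'_mul (hg0 a j) (hX1 a i),
      pderiv'_mul (hg0 i a) (hX1 a j), pderiv'_comm hU (hg i j) hp k a]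
  rw [hleft, key, mul_add, Finset.mul_sum]
  congr 1
  · refine Finset.sum_congr rfl fun m _ => ?_
    rw [symX_eq_lie_derivative hU hg hsymm hinv hX hp m j,
      symX_eq_lie_derivative hU hg hsymm hinv hX hp i m]
    ring
  · simp only [mul_add, Finset.sum_add_distrib, mul_ite, mul_one, mul_zero,
      Finset.sum_ite_eq', Finset.mem_univ, if_true]
    ring

theorem pderiv'_divX_of_projective (hU : IsOpen U)
    (hg : ∀ i j, ContDiffOn ℝ (⊤ : ℕ∞) (fun p => g p i j) U)
    (hsymm : ∀ p ∈ U, ∀ i j, g p i j = g p j i)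
    (hinv : ∀ p ∈ U, IsUnit (Matrix.of (g p)).det)
    (hX : ∀ i, ContDiffOn ℝ (⊤ : ℕ∞) (fun p => X p i) U) {p : Fin n → ℝ} (hp : p ∈ U)
    (hproj : ∀ i j k : Fin n,
      ∑ a, X p a * pderiv' n (christoffel n g i j k) a p
        - ∑ a, christoffel n g a j k p * pderiv' n (fun q => X q i) a p
        + ∑ a, christoffel n g i a k p * pderiv' n (fun q => X q a) j p
        + ∑ a, christoffel n g i j a p * pderiv' n (fun q => X q a) k p
        + pderiv' n (fun q => pderiv' n (fun r => X r i) k q) j p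
      = μ p j * (if i = k then 1 else 0) + μ p k * (if i = j then 1 else 0))
    (k : Fin n) :
    pderiv' n (divX n g X) k p = ((n : ℝ) + 1) * μ p k := by
  have hX0 (i : Fin n) : DifferentiableAt ℝ (fun q => X q i) p :=
    (hX i).differentiableAt_of_mem_isOpen hU hp
  have hX1 (i a : Fin n) : DifferentiableAt ℝ (pderiv' n (fun q => X q i) a) p :=
    (contDiffOn_pderiv' hU (hX i) a).differentiableAt_of_mem_isOpen hU hp
  have hG0 (i j k : Fin n) : DifferentiableAt ℝ (christoffel n g i j k) p :=
    (contDiffOn_christoffel hU hg hinv i j k).differentiableAt_of_mem_isOpen hU hp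
  have hXG (i j : Fin n) := (hX0 j).fun_mul (hG0 i i j)
  have hleft : pderiv' n (divX n g X) k p =
      ∑ i, pderiv' n (pderiv' n (fun q => X q i) k) i p
      + (∑ i, ∑ j, christoffel n g i i j p * pderiv' n (fun q => X q j) k p
        + ∑ j, X p j * ∑ i, pderiv' n (christoffel n g i i j) k p) := by
    change pderiv' n (fun q => ∑ i, pderiv' n (fun q => X q i) i q
      + ∑ i, ∑ j, X q j * christoffel n g i i j q) k p = _
    rw [pderiv'_add (DifferentiableAt.fun_sum fun i _ => hX1 i i)
      (DifferentiableAt.fun_sum fun i _ => DifferentiableAt.fun_sum fun j _ => hXG i j),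
      pderiv'_sum fun i _ => hX1 i i,
      pderiv'_sum fun i _ => DifferentiableAt.fun_sum fun j _ => hXG i j]
    congr 1
    · exact Finset.sum_congr rfl fun i _ => pderiv'_comm hU (hX i) hp i k
    · simp only [Finset.mul_sum]
      rw [Finset.sum_comm (f := fun j i => X p j * pderiv' n (christoffel n g i i j) k p)]
      simp only [← Finset.sum_add_distrib]
      refine Finset.sum_congr rfl fun i _ => ?_
      rw [pderiv'_sum fun j _ => hXG i j]
      refine Finset.sum_congr rfl fun j _ => ?_
      rw [pderiv'_mul (hX0 j) (hG0 i i j)]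
      ring
  have htrace := Finset.sum_congr (rfl : Finset.univ = Finset.univ) fun i _ => hproj i i k
  have hswap : ∑ i, ∑ a, christoffel n g a i k p * pderiv' n (fun q => X q i) a p =
      ∑ i, ∑ a, christoffel n g i a k p * pderiv' n (fun q => X q a) i p := Finset.sum_comm
  have hX2 : ∑ i, ∑ a, X p a * pderiv' n (christoffel n g i i k) a p =
      ∑ a, X p a * ∑ i, pderiv' n (christoffel n g i i a) k p := by
    rw [Finset.sum_comm]
    refine Finset.sum_congr rfl fun a _ => ?_
    rw [← Finset.mul_sum, sum_pderiv'_christoffel_comm hU hg hsymm hinv hp k a]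
  simp only [Finset.sum_add_distrib, Finset.sum_sub_distrib, hX2, hswap, mul_ite, mul_one,
    mul_zero, Finset.sum_ite_eq', Finset.mem_univ, if_true, Finset.sum_const, Finset.card_univ,
    Fintype.card_fin, nsmul_eq_mul] at htrace
  rw [hleft]
  linear_combination htrace

end Metric

/-- If `X` is a projective vector field of the metric `g`, then
`I_X = (X_{(i;j)} − 2/(n+1)·div X·g_{ij}) ẋ^i ẋ^j` is a quadratic first integral of the
geodesic flow of `g`. -/
theorem stmt_9 (n : ℕ) (hn : 2 ≤ n)
    (U : Set (Fin n → ℝ)) (hU : IsOpen U)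
    (g : (Fin n → ℝ) → Fin n → Fin n → ℝ)
    (hg_smooth : ∀ i j, ContDiffOn ℝ (⊤ : ℕ∞) (fun p => g p i j) U)
    (hg_symm : ∀ p ∈ U, ∀ i j, g p i j = g p j i)
    (hg_inv : ∀ p ∈ U, IsUnit (Matrix.of (g p)).det)
    (X : (Fin n → ℝ) → Fin n → ℝ)
    (hX_smooth : ∀ i, ContDiffOn ℝ (⊤ : ℕ∞) (fun p => X p i) U)
    (μ : (Fin n → ℝ) → Fin n → ℝ)
    (hμ_smooth : ∀ i, ContDiffOn ℝ (⊤ : ℕ∞) (fun p => μ p i) U)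
    (hproj : ∀ p ∈ U, ∀ i j k : Fin n,
      ∑ a, X p a * pderiv' n (christoffel n g i j k) a p
        - ∑ a, christoffel n g a j k p * pderiv' n (fun q => X q i) a p
        + ∑ a, christoffel n g i a k p * pderiv' n (fun q => X q a) j p
        + ∑ a, christoffel n g i j a p * pderiv' n (fun q => X q a) k p
        + pderiv' n (fun q => pderiv' n (fun r => X r i) k q) j p
      = μ p j * (if i = k then 1 else 0) + μ p k * (if i = j then 1 else 0))
    (I : Set ℝ) (hIopen : IsOpen I) (hIconn : I.OrdConnected)
    (γ γ' γ'' : ℝ → Fin n → ℝ)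
    (hmem : ∀ t ∈ I, γ t ∈ U)
    (hd1 : ∀ t ∈ I, ∀ k, HasDerivAt (fun τ => γ τ k) (γ' t k) t)
    (hd2 : ∀ t ∈ I, ∀ k, HasDerivAt (fun τ => γ' τ k) (γ'' t k) t)
    (hgeo : ∀ t ∈ I, ∀ k,
      γ'' t k + ∑ i, ∑ j, christoffel n g k i j (γ t) * γ' t i * γ' t j = 0) :
    ∀ t₁ ∈ I, ∀ t₂ ∈ I,
      (∑ i, ∑ j,
          (symX n g X (γ t₁) i j
            - (2 / ((n : ℝ) + 1)) * divX n g X (γ t₁) * g (γ t₁) i j)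
            * γ' t₁ i * γ' t₁ j) =
      (∑ i, ∑ j,
          (symX n g X (γ t₂) i j
            - (2 / ((n : ℝ) + 1)) * divX n g X (γ t₂) * g (γ t₂) i j)
            * γ' t₂ i * γ' t₂ j) := by
  set c : ℝ := 2 / ((n : ℝ) + 1) with hc
  have hcn : c * ((n : ℝ) + 1) = 2 := div_mul_cancel₀ _ (by positivity)
  have hderiv : ∀ t ∈ I, HasDerivAt (fun τ => ∑ i, ∑ j,
      (symX n g X (γ τ) i j - c * divX n g X (γ τ) * g (γ τ) i j) * γ' τ i * γ' τ j) 0 t := by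
    intro t ht
    have hp := hmem t ht
    have hsym (i j : Fin n) : DifferentiableAt ℝ (fun q => symX n g X q i j) (γ t) :=
      (contDiffOn_symX hU hg_smooth hg_symm hg_inv hX_smooth i
        j).differentiableAt_of_mem_isOpen hU hp
    have hdiv : DifferentiableAt ℝ (divX n g X) (γ t) :=
      (contDiffOn_divX hU hg_smooth hg_inv hX_smooth).differentiableAt_of_mem_isOpen hU hp
    have hg0 (i j : Fin n) : DifferentiableAt ℝ (fun q => g q i j) (γ t) :=
      (hg_smooth i j).differentiableAt_of_mem_isOpen hU hp
    have hcdiv : DifferentiableAt ℝ (fun q => c * divX n g X q) (γ t) := hdiv.const_mul c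
    have hK (i j : Fin n) := (hsym i j).fun_sub (hcdiv.fun_mul (hg0 i j))
    have hsum := HasDerivAt.fun_sum fun i (_ : i ∈ Finset.univ) =>
      HasDerivAt.fun_sum fun j (_ : j ∈ Finset.univ) =>
        ((hasDerivAt_comp_curve (hK i j) (hd1 t ht)).fun_mul (hd2 t ht i)).fun_mul (hd2 t ht j)
    refine hsum.congr_deriv ?_
    have hSd (i j k : Fin n) :
        pderiv' n (fun q => symX n g X q i j - c * divX n g X q * g q i j) k (γ t) =
        ∑ m, (christoffel n g m k i (γ t)
            * (symX n g X (γ t) m j - c * divX n g X (γ t) * g (γ t) m j)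
          + christoffel n g m k j (γ t)
            * (symX n g X (γ t) i m - c * divX n g X (γ t) * g (γ t) i m))
        + (1 / 2 * (μ (γ t) i * g (γ t) k j + μ (γ t) j * g (γ t) i k)
          - μ (γ t) k * g (γ t) i j) := by
      rw [pderiv'_sub (hsym i j) (hcdiv.fun_mul (hg0 i j)), pderiv'_mul hcdiv (hg0 i j),
        pderiv'_const_mul c hdiv,
        pderiv'_symX_of_projective hU hg_smooth hg_symm hg_inv hX_smooth hp (hproj _ hp),
        pderiv'_divX_of_projective hU hg_smooth hg_symm hg_inv hX_smooth hp (hproj _ hp),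
        pderiv'_metric hU hg_symm hg_inv hp]
      have hsplit : ∑ m, (christoffel n g m k i (γ t)
            * (symX n g X (γ t) m j - c * divX n g X (γ t) * g (γ t) m j)
          + christoffel n g m k j (γ t)
            * (symX n g X (γ t) i m - c * divX n g X (γ t) * g (γ t) i m)) =
          ∑ m, (christoffel n g m k i (γ t) * symX n g X (γ t) m j
            + christoffel n g m k j (γ t) * symX n g X (γ t) i m)
          - c * divX n g X (γ t) * ∑ m, (g (γ t) m j * christoffel n g m k i (γ t)
            + g (γ t) i m * christoffel n g m k j (γ t)) := by
        rw [Finset.mul_sum, ← Finset.sum_sub_distrib]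
        exact Finset.sum_congr rfl fun m _ => by ring
      rw [hsplit]
      linear_combination -(μ (γ t) k * g (γ t) i j) * hcn
    rw [quadratic_form_derivative_geodesic
      (S := fun i j => symX n g X (γ t) i j - c * divX n g X (γ t) * g (γ t) i j)
      (G := fun k i j => christoffel n g k i j (γ t)) hSd (hgeo t ht)]
    have h1 : ∑ i, ∑ j, ∑ k, μ (γ t) i * g (γ t) k j * γ' t i * γ' t j * γ' t k =
        ∑ i, ∑ j, ∑ k, μ (γ t) k * g (γ t) i j * γ' t i * γ' t j * γ' t k := by
      rw [sum_swap_first_third]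
      exact Finset.sum_congr rfl fun i _ => Finset.sum_congr rfl fun j _ =>
        Finset.sum_congr rfl fun k _ => by ring
    have h2 : ∑ i, ∑ j, ∑ k, μ (γ t) j * g (γ t) i k * γ' t i * γ' t j * γ' t k =
        ∑ i, ∑ j, ∑ k, μ (γ t) k * g (γ t) i j * γ' t i * γ' t j * γ' t k := by
      refine Finset.sum_congr rfl fun i _ => ?_
      rw [Finset.sum_comm]
      exact Finset.sum_congr rfl fun j _ => Finset.sum_congr rfl fun k _ => by ring
    simp only [sub_mul, mul_add, add_mul, Finset.sum_sub_distrib, Finset.sum_add_distrib,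
      mul_assoc, ← Finset.mul_sum] at h1 h2 ⊢
    linear_combination (1 / 2) * h1 + (1 / 2) * h2
  intro t₁ h₁ t₂ h₂
  exact hIopen.is_const_of_deriv_eq_zero hIconn.isPreconnected
    (fun t ht => (hderiv t ht).differentiableAt.differentiableWithinAt)
    (fun t ht => (hderiv t ht).deriv) h₁ h₂
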